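/- ∫_{1/2}^{1} log Γ(x) dx = (log π)/4 - 1/8 + (7/24)·log 2 + (3/2)·ζ'(-1). -/

import Mathlib

open Real MeasureTheory
open Set Filter Topology

lemma diff_bound {f f' : ℝ → ℂ} {a C : ℝ} (h : ∀ x, a ≤ x → HasDerivAt f (f' x) x)
    (hb : ∀ x, a ≤ x → ‖f' x‖ ≤ C) : ∀ x, a ≤ x → ‖f (x + 1/2) - f x‖ ≤ C := by
  intro x hx
  have := (convex_Ici a).norm_image_sub_le_of_norm_hasDerivWithin_le (f := f) (f' := f') (C := C)
    (fun y hy => (h y hy).hasDerivWithinAt) (fun y hy => hb y hy) (x := x) (y := x + 1/2) hx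
    (show a ≤ x + 1/2 by linarith)
  have hC : 0 ≤ C := (norm_nonneg _).trans (hb x hx)
  have e : ‖x + 1/2 - x‖ = 1/2 := by rw [add_sub_cancel_left]; norm_num
  rw [e] at this
  linarith

lemma hasDeriv_pow (c : ℂ) (x : ℝ) (hx : 0 < x) :
    HasDerivAt (fun y : ℝ => (y : ℂ) ^ c) (c * (x : ℂ) ^ (c - 1)) x := by
  have := ((hasDerivAt_id (x : ℂ)).cpow_const (c := c) (Or.inl (by simpa using hx))).comp_ofReal
  simpa using this

lemma third_bound (s : ℂ) (a : ℝ) (ha : 0 < a) (C : ℝ)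
    (hC : ∀ x, a ≤ x → ‖(-s) * ((-s-1) * ((-s-1-1) * (x : ℂ) ^ (-s-1-1-1)))‖ ≤ C) :
    ‖((a : ℝ) : ℂ) ^ (-s) - 3 * ((a + 1/2 : ℝ) : ℂ) ^ (-s) + 3 * ((a + 1 : ℝ) : ℂ) ^ (-s)
      - ((a + 3/2 : ℝ) : ℂ) ^ (-s)‖ ≤ C := by
  have sh : ∀ {f f' : ℝ → ℂ}, (∀ x, a ≤ x → HasDerivAt f (f' x) x) →
      (∀ x, a ≤ x → HasDerivAt (fun y => f (y + 1/2) - f y) (f' (x + 1/2) - f' x) x) := by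
    intro f f' h x hx
    exact ((h (x + 1/2) (by linarith)).comp_add_const x (1/2)).sub (h x hx)
  have h0 : ∀ x, a ≤ x → HasDerivAt (fun y : ℝ => (y : ℂ) ^ (-s)) ((-s) * (x : ℂ) ^ (-s-1)) x :=
    fun x hx => hasDeriv_pow _ x (by linarith)
  have h1 : ∀ x, a ≤ x → HasDerivAt (fun y : ℝ => (-s) * (y : ℂ) ^ (-s-1))
      ((-s) * ((-s-1) * (x : ℂ) ^ (-s-1-1))) x :=
    fun x hx => (hasDeriv_pow _ x (by linarith)).const_mul _
  have h2 : ∀ x, a ≤ x → HasDerivAt (fun y : ℝ => (-s) * ((-s-1) * (y : ℂ) ^ (-s-1-1)))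
      ((-s) * ((-s-1) * ((-s-1-1) * (x : ℂ) ^ (-s-1-1-1)))) x :=
    fun x hx => ((hasDeriv_pow _ x (by linarith)).const_mul _).const_mul _
  have b2 := diff_bound h2 hC
  have b1 := diff_bound (sh h1) b2
  have b0 := diff_bound (sh (sh h0)) b1 a le_rfl
  rw [show a + 1/2 + 1/2 + 1/2 = a + 3/2 by ring, show a + 1/2 + 1/2 = a + 1 by ring] at b0
  refine le_of_eq_of_le ?_ b0
  rw [← norm_neg]
  congr 1
  ring

noncomputable def tt (n : ℕ) (s : ℂ) : ℂ :=
  ((n + 1/2 : ℝ) : ℂ) ^ (-s) - 3 * ((n + 1 : ℝ) : ℂ) ^ (-s) + 3 * ((n + 3/2 : ℝ) : ℂ) ^ (-s)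
      - ((n + 2 : ℝ) : ℂ) ^ (-s)

lemma tt_bound (n : ℕ) (s : ℂ) (hs : s ∈ Metric.ball (1/2 : ℂ) 2) :
    ‖tt n s‖ ≤ 3840 * ((n : ℝ) + 1) ^ (-(3/2) : ℝ) := by
  have hs' : ‖s - 1/2‖ < 2 := by simpa [dist_eq_norm] using hs
  have n1 : ‖s‖ ≤ 3 := by
    have : ‖s‖ ≤ ‖s - 1/2‖ + ‖(1/2 : ℂ)‖ := by simpa using norm_add_le (s - 1/2) (1/2)
    have : ‖(1/2 : ℂ)‖ = 1/2 := by norm_num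
    linarith
  have hre : -(3/2) < s.re ∧ s.re < 5/2 := by
    have := (abs_lt.1 ((Complex.abs_re_le_norm _).trans_lt hs'))
    simp at this
    constructor <;> linarith
  have m0 : ‖-s‖ ≤ 3 := by simpa using n1
  have m1 : ‖-s-1‖ ≤ 4 := by
    have := norm_sub_le (-s) 1
    simp only [norm_one] at this; linarith
  have m2 : ‖-s-1-1‖ ≤ 5 := by
    have := norm_sub_le (-s-1) 1
    simp only [norm_one] at this; linarith
  have := third_bound s (n + 1/2) (by positivity) (3840 * ((n : ℝ) + 1) ^ (-(3/2) : ℝ)) ?_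
  · rw [show (n : ℝ) + 1/2 + 1/2 = n + 1 by ring, show (n : ℝ) + 1/2 + 1 = n + 3/2 by ring,
      show (n : ℝ) + 1/2 + 3/2 = n + 2 by ring] at this
    exact this
  · intro x hx
    have hn : (0:ℝ) ≤ n := n.cast_nonneg
    have hx0 : 0 < x := by linarith
    rw [norm_mul, norm_mul, norm_mul, Complex.norm_cpow_eq_rpow_re_of_pos hx0]
    have key : x ^ (-s-1-1-1).re ≤ 64 * ((n : ℝ) + 1) ^ (-(3/2) : ℝ) := by
      have e : x = (2 * x) * (1/2) := by ring
      rw [e, Real.mul_rpow (by positivity) (by norm_num), mul_comm]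
      have a1 : ((1:ℝ)/2) ^ (-s-1-1-1).re ≤ 64 := by
        calc ((1:ℝ)/2) ^ (-s-1-1-1).re ≤ (1/2) ^ (-6 : ℝ) := by
              apply Real.rpow_le_rpow_of_exponent_ge (by norm_num) (by norm_num)
              simp; linarith
          _ = 64 := by
              rw [Real.rpow_neg (by norm_num)]; norm_num
      have a2 : (2 * x) ^ (-s-1-1-1).re ≤ ((n : ℝ) + 1) ^ (-(3/2) : ℝ) := by
        calc (2 * x) ^ (-s-1-1-1).re ≤ (2 * x) ^ (-(3/2) : ℝ) := by
              apply Real.rpow_le_rpow_of_exponent_le (by linarith)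
              simp; linarith
          _ ≤ _ := Real.rpow_le_rpow_of_nonpos (by positivity) (by linarith) (by norm_num)
      exact mul_le_mul a1 a2 (by positivity) (by norm_num)
    calc _ ≤ 3 * (4 * (5 * (64 * ((n : ℝ) + 1) ^ (-(3/2) : ℝ)))) := by gcongr
      _ = _ := by ring

lemma summable_u : Summable (fun n : ℕ => 3840 * ((n : ℝ) + 1) ^ (-(3/2) : ℝ)) := by
  apply Summable.mul_left
  have := (summable_nat_add_iff 1).2 (Real.summable_nat_rpow.2 (show (-(3/2) : ℝ) < -1 by norm_num))
  simpa using this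

lemma diff_x (x : ℝ) (hx : 0 < x) (s : ℂ) :
    HasDerivAt (fun s : ℂ => (x : ℂ) ^ (-s)) (-(Real.log x : ℂ) * (x : ℂ) ^ (-s)) s := by
  have := (hasDerivAt_neg s).const_cpow (c := (x : ℂ)) (Or.inl (by exact_mod_cast hx.ne'))
  convert this using 1
  rw [Complex.ofReal_log hx.le]; ring

lemma tt_diff (n : ℕ) (s : ℂ) : DifferentiableAt ℂ (tt n) s := by
  unfold tt
  have h := fun x hx => (diff_x x hx s).differentiableAt
  have h1 := h (n + 1/2) (by positivity)
  have h2 := h (n + 1) (by positivity)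
  have h3 := h (n + 3/2) (by positivity)
  have h4 := h (n + 2) (by positivity)
  exact ((h1.sub (h2.const_mul _)).add (h3.const_mul _)).sub h4

noncomputable def gg (x : ℝ) : ℝ := - (x * Real.log x)

lemma diff_x' (x : ℝ) (hx : 0 < x) :
    HasDerivAt (fun s : ℂ => (x : ℂ) ^ (-s)) ((gg x : ℝ) : ℂ) (-1) := by
  convert diff_x x hx (-1) using 1
  simp [gg]; ring

noncomputable def dd (n : ℕ) : ℝ :=
  gg (n + 1/2) - 3 * gg (n + 1) + 3 * gg (n + 3/2) - gg (n + 2)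

lemma tt_deriv (n : ℕ) : HasDerivAt (tt n) ((dd n : ℝ) : ℂ) (-1) := by
  have h1 := diff_x' (n + 1/2) (by positivity)
  have h2 := diff_x' (n + 1) (by positivity)
  have h3 := diff_x' (n + 3/2) (by positivity)
  have h4 := diff_x' (n + 2) (by positivity)
  have h5 : HasDerivAt (tt n) _ (-1) := ((h1.sub (h2.const_mul 3)).add (h3.const_mul 3)).sub h4
  refine h5.congr_deriv ?_
  simp [dd]

noncomputable def GG (s : ℂ) : ℂ :=
  3/4 * ((1/2 : ℝ) : ℂ) ^ (-s) - 1/4 * ((1 : ℝ) : ℂ) ^ (-s) + 1/4 * ∑' n, tt n s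

lemma GG_diff : DifferentiableOn ℂ GG (Metric.ball (1/2 : ℂ) 2) := by
  have h := Complex.differentiableOn_tsum_of_summable_norm summable_u
    (fun n => fun s _ => (tt_diff n s).differentiableWithinAt) Metric.isOpen_ball tt_bound
  have a := fun x hx s => (diff_x x hx s).differentiableAt
  intro s hs
  exact ((((a (1/2) (by norm_num) s).const_mul _).sub ((a 1 one_pos s).const_mul _)).differentiableWithinAt).add
    ((h s hs).const_mul _)

lemma mem_ball' : (-1 : ℂ) ∈ Metric.ball (1/2 : ℂ) 2 := by
  rw [Metric.mem_ball, dist_eq_norm]; norm_num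

lemma GG_deriv : HasSum (fun n => (dd n : ℝ)) (4 * (deriv GG (-1)).re - 3 * gg (1/2) + gg 1) := by
  have h := Complex.hasSum_deriv_of_summable_norm summable_u
    (fun n => fun s _ => (tt_diff n s).differentiableWithinAt) Metric.isOpen_ball tt_bound mem_ball'
  have hd := Complex.differentiableOn_tsum_of_summable_norm summable_u
    (fun n => fun s _ => (tt_diff n s).differentiableWithinAt) Metric.isOpen_ball tt_bound
  have hd1 := (hd.differentiableAt (Metric.isOpen_ball.mem_nhds mem_ball')).hasDerivAt
  have e : HasDerivAt GG (3/4 * ((gg (1/2) : ℝ) : ℂ) - 1/4 * ((gg 1 : ℝ) : ℂ)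
    + 1/4 * deriv (fun w => ∑' n, tt n w) (-1)) (-1) :=
    (((diff_x' (1/2) (by norm_num)).const_mul _).sub ((diff_x' 1 one_pos).const_mul _)).add
      (hd1.const_mul _)
  have h2 := Complex.hasSum_re h
  simp only [(tt_deriv _).deriv, Complex.ofReal_re] at h2
  convert h2 using 1
  rw [e.deriv]
  simp
  ring

noncomputable def EE (s : ℂ) : ℂ :=
  HurwitzZeta.hurwitzZeta ((1/2 : ℝ) : UnitAddCircle) s - HurwitzZeta.hurwitzZeta 0 s

lemma EE_diff : Differentiable ℂ EE :=
  HurwitzZeta.differentiable_hurwitzZeta_sub_hurwitzZeta _ _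

lemma sum_half {s : ℂ} (hs : 1 < s.re) :
    HasSum (fun n : ℕ => ((n + 1/2 : ℝ) : ℂ) ^ (-s))
      (HurwitzZeta.hurwitzZeta ((1/2 : ℝ) : UnitAddCircle) s) := by
  have := HurwitzZeta.hasSum_hurwitzZeta_of_one_lt_re (a := 1/2) (by constructor <;> norm_num) hs
  convert this using 2 with n
  rw [Complex.cpow_neg]; simp

lemma sum_one {s : ℂ} (hs : 1 < s.re) :
    HasSum (fun n : ℕ => ((n + 1 : ℝ) : ℂ) ^ (-s)) (riemannZeta s) := by
  have := HurwitzZeta.hasSum_hurwitzZeta_of_one_lt_re (a := 1) (by constructor <;> norm_num) hs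
  rw [AddCircle.coe_period, HurwitzZeta.hurwitzZeta_zero] at this
  convert this using 2 with n
  rw [Complex.cpow_neg]; simp

lemma EE_eq_one {s : ℂ} (hs : 1 < s.re) : EE s = (2 ^ s - 2) * riemannZeta s := by
  have h1 := sum_half hs
  have h2 := sum_one hs
  have key : ∀ x : ℝ, 0 < x → ((2 * x : ℝ) : ℂ) ^ (-s) = 2 ^ (-s) * (x : ℂ) ^ (-s) := by
    intro x hx
    rw [Complex.ofReal_mul, Complex.mul_cpow_ofReal_nonneg (by norm_num) hx.le]
    norm_num
  have h3 := h1.mul_left ((2 : ℂ) ^ (-s))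
  have h4 := h2.mul_left ((2 : ℂ) ^ (-s))
  have e3 : ∀ n : ℕ, (2 : ℂ) ^ (-s) * ((n + 1/2 : ℝ) : ℂ) ^ (-s) =
      (((2 * n : ℕ) + 1 : ℝ) : ℂ) ^ (-s) := by
    intro n
    rw [← key _ (by positivity), show (2 * ((n : ℝ) + 1/2)) = ((2 * n : ℕ) + 1 : ℝ) by push_cast; ring]
  have e4 : ∀ n : ℕ, (2 : ℂ) ^ (-s) * ((n + 1 : ℝ) : ℂ) ^ (-s) =
      (((2 * n + 1 : ℕ) + 1 : ℝ) : ℂ) ^ (-s) := by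
    intro n
    rw [← key _ (by positivity), show (2 * ((n : ℝ) + 1)) = ((2 * n + 1 : ℕ) + 1 : ℝ) by push_cast; ring]
  simp only [e3] at h3
  simp only [e4] at h4
  have h5 := (HasSum.even_add_odd (f := fun k : ℕ => ((k + 1 : ℝ) : ℂ) ^ (-s)) h3 h4).unique h2
  have h6 : (2 : ℂ) ^ s * 2 ^ (-s) = 1 := by
    rw [← Complex.cpow_add _ _ two_ne_zero, add_neg_cancel, Complex.cpow_zero]
  rw [EE, HurwitzZeta.hurwitzZeta_zero]
  clear h1 h2 h3 h4 e3 e4 key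
  generalize HurwitzZeta.hurwitzZeta ((1/2 : ℝ) : UnitAddCircle) s = H at *
  linear_combination (2 : ℂ) ^ s * h5 - (H + riemannZeta s) * h6

lemma EE_eq {s : ℂ} (hs : s ≠ 1) : EE s = (2 ^ s - 2) * riemannZeta s := by
  have := AnalyticOnNhd.eqOn_of_preconnected_of_eventuallyEq (𝕜 := ℂ) (f := EE)
    (g := fun s => (2 ^ s - 2) * riemannZeta s) (U := {1}ᶜ) (z₀ := 2)
    (EE_diff.differentiableOn.analyticOnNhd isOpen_compl_singleton)
    (DifferentiableOn.analyticOnNhd (fun s hs => DifferentiableAt.differentiableWithinAt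
      (((differentiableAt_id.const_cpow (Or.inl two_ne_zero)).sub_const _).mul
        (differentiableAt_riemannZeta hs))) isOpen_compl_singleton)
    (isConnected_compl_singleton_of_one_lt_rank (by simp) 1).isPreconnected (by norm_num)
    (eventuallyEq_of_mem ((isOpen_lt continuous_const Complex.continuous_re).mem_nhds
      (show (1 : ℝ) < (2 : ℂ).re by norm_num)) (fun s hs => EE_eq_one hs))
  exact this hs

lemma EE_eq_GG_one {s : ℂ} (hs : 1 < s.re) : EE s = GG s := by
  have h1 := sum_half hs
  have h2 := sum_one hs
  have h3 := (hasSum_nat_add_iff' 1).2 h1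
  have h4 := (hasSum_nat_add_iff' 1).2 h2
  have h5 := ((h1.sub (h2.mul_left 3)).add (h3.mul_left 3)).sub h4
  have h6 := h5.tsum_eq
  have h7 : ∑' n, tt n s = _ := Eq.trans (by
    congr 1
    ext n
    rw [tt]
    push_cast
    rw [show (n : ℂ) + 1 + 1/2 = n + 3/2 by ring, show (n : ℂ) + 1 + 1 = n + 2 by ring]) h6
  rw [GG, h7, EE, HurwitzZeta.hurwitzZeta_zero]
  simp
  ring

lemma EE_eventually : EE =ᶠ[𝓝 (-1)] GG := by
  have := AnalyticOnNhd.eqOn_of_preconnected_of_eventuallyEq (𝕜 := ℂ) (f := EE)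
    (g := GG) (U := Metric.ball (1/2 : ℂ) 2) (z₀ := 2)
    (EE_diff.differentiableOn.analyticOnNhd Metric.isOpen_ball)
    (GG_diff.analyticOnNhd Metric.isOpen_ball)
    (convex_ball _ _).isPreconnected (by rw [Metric.mem_ball, dist_eq_norm]; norm_num)
    (eventuallyEq_of_mem ((isOpen_lt continuous_const Complex.continuous_re).mem_nhds
      (show (1 : ℝ) < (2 : ℂ).re by norm_num)) (fun s hs => EE_eq_GG_one hs))
  exact this.eventuallyEq_of_mem (Metric.isOpen_ball.mem_nhds mem_ball')

lemma zeta_neg_one : riemannZeta (-1) = -1/12 := by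
  have := riemannZeta_neg_nat_eq_bernoulli 1
  simp [bernoulli_two] at this
  rw [this]; norm_num

lemma GG_deriv_val : (deriv GG (-1)).re = - Real.log 2 / 24 - 3/2 * (deriv riemannZeta (-1)).re := by
  rw [← EE_eventually.deriv_eq]
  have h1 : EE =ᶠ[𝓝 (-1)] fun s => (2 ^ s - 2) * riemannZeta s :=
    eventuallyEq_of_mem (isOpen_compl_singleton.mem_nhds (show (-1 : ℂ) ∈ {1}ᶜ by norm_num))
      (fun s hs => EE_eq hs)
  rw [h1.deriv_eq]
  have h2 : HasDerivAt (fun s : ℂ => (2 : ℂ) ^ s - 2) _ (-1) :=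
    ((hasDerivAt_id (-1 : ℂ)).const_cpow (c := 2) (Or.inl two_ne_zero)).sub_const 2
  have h3 := h2.mul (differentiableAt_riemannZeta (s := -1) (by norm_num)).hasDerivAt
  have h4 : HasDerivAt (fun s => (2 ^ s - 2) * riemannZeta s) _ (-1 : ℂ) := h3
  rw [h4.deriv, zeta_neg_one]
  have e : (2 : ℂ) ^ (-1 : ℂ) = ((1/2 : ℝ) : ℂ) := by rw [Complex.cpow_neg_one]; norm_num
  have l : Complex.log 2 = ((Real.log 2 : ℝ) : ℂ) := by rw [Complex.ofReal_log (by norm_num)]; norm_num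
  simp only [id, e, l]
  have e2 : ((1/2 : ℝ) : ℂ) * ((Real.log 2 : ℝ) : ℂ) * 1 * (-1/12) + (((1/2 : ℝ) : ℂ) - 2) * deriv riemannZeta (-1)
    = ((-Real.log 2 / 24 : ℝ) : ℂ) + ((-(3/2) : ℝ) : ℂ) * deriv riemannZeta (-1) := by
    push_cast; ring
  rw [e2, Complex.add_re, Complex.ofReal_re, Complex.re_ofReal_mul]
  ring

noncomputable def SS (N : ℕ) : ℝ := ∑ m ∈ Finset.range N, (gg (m + 1/2) - gg (m + 1))

lemma sum_dd (N : ℕ) : ∑ m ∈ Finset.range N, dd m =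
    4 * SS N - (3 * gg (1/2) - gg 1) + (3 * gg (N + 1/2) - gg (N + 1)) := by
  induction N with
  | zero => simp [SS]
  | succ n ih =>
    rw [Finset.sum_range_succ, ih, SS, SS, Finset.sum_range_succ, dd]
    push_cast
    rw [show (n : ℝ) + 1 + 1/2 = n + 3/2 by ring, show (n : ℝ) + 1 + 1 = n + 2 by ring]
    ring

lemma lim_SS : Tendsto (fun N : ℕ => SS N + (3/4 * gg (N + 1/2) - 1/4 * gg (N + 1))) atTop
    (𝓝 ((deriv GG (-1)).re)) := by
  have := ((GG_deriv.tendsto_sum_nat).add_const (3 * gg (1/2) - gg 1)).div_const 4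
  convert this using 2
  · rw [sum_dd]; ring
  · ring

lemma feq : ∀ {y : ℝ}, 0 < y → (Real.log ∘ Real.Gamma) (y + 1) = (Real.log ∘ Real.Gamma) y + Real.log y := by
  intro y hy
  simp only [Function.comp_apply]
  rw [Real.Gamma_add_one hy.ne', Real.log_mul hy.ne' (Real.Gamma_pos_of_pos hy).ne', add_comm]

lemma int_log (m : ℕ) : ∫ x in (1/2 : ℝ)..1, Real.log (x + m) = gg (m + 1/2) - gg (m + 1) - 1/2 := by
  rw [intervalIntegral.integral_comp_add_right (fun x => Real.log x), integral_log, gg, gg,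
    add_comm (1/2 : ℝ), add_comm (1 : ℝ)]
  ring

lemma ii_log (m : ℕ) : IntervalIntegrable (fun x : ℝ => Real.log (x + m)) volume (1/2) 1 := by
  apply ContinuousOn.intervalIntegrable
  intro x hx
  rw [uIcc_of_le (by norm_num)] at hx
  have : 0 < x + m := by have := hx.1; positivity
  exact ((continuousAt_id.add continuousAt_const).log this.ne').continuousWithinAt

lemma ii_ls (N : ℕ) : IntervalIntegrable (fun x : ℝ => ∑ m ∈ Finset.range N, Real.log (x + m))
    volume (1/2) 1 := by
  have := IntervalIntegrable.sum (Finset.range N) (fun m _ => ii_log m)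
  rwa [show (∑ m ∈ Finset.range N, fun x : ℝ => Real.log (x + m)) =
    fun x : ℝ => ∑ m ∈ Finset.range N, Real.log (x + m) by ext x; simp] at this

lemma ii_G : IntervalIntegrable (fun x : ℝ => Real.log (Real.Gamma x)) volume (1/2) 1 := by
  apply ContinuousOn.intervalIntegrable
  intro x hx
  rw [uIcc_of_le (by norm_num)] at hx
  have h0 : 0 < x := by have := hx.1; linarith
  have := (Real.differentiableAt_Gamma (s := x) (fun m => by
    have : (0:ℝ) ≤ m := m.cast_nonneg
    linarith)).continuousAt
  exact (this.log (Real.Gamma_pos_of_pos h0).ne').continuousWithinAt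

noncomputable def II : ℝ := ∫ x in (1/2 : ℝ)..1, Real.log (Real.Gamma x)

lemma int_sum (N : ℕ) : ∫ x in (1/2 : ℝ)..1, (Real.log (Real.Gamma x) +
    ∑ m ∈ Finset.range N, Real.log (x + m)) = II + SS N - N / 2 := by
  rw [intervalIntegral.integral_add ii_G (ii_ls N),
    intervalIntegral.integral_finsetSum (fun m _ => ii_log m)]
  simp only [int_log, Finset.sum_sub_distrib, II, SS]
  simp
  ring

lemma int_lin (a b : ℝ) : ∫ x in (1/2 : ℝ)..1, (a + x * b) = a / 2 + 3/8 * b := by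
  rw [intervalIntegral.integral_add (by simp) (by apply Continuous.intervalIntegrable; fun_prop)]
  simp
  ring

lemma ii_sum (N : ℕ) : IntervalIntegrable (fun x : ℝ => Real.log (Real.Gamma x) +
    ∑ m ∈ Finset.range N, Real.log (x + m)) volume (1/2) 1 :=
  ii_G.add (ii_ls N)

lemma upper (N : ℕ) (hN : 2 ≤ N) : II + SS N - N / 2 ≤
    Real.log (Real.Gamma N) / 2 + 3/8 * Real.log N := by
  rw [← int_sum, ← int_lin]
  apply intervalIntegral.integral_mono_on (by norm_num) (ii_sum N)
    (by apply Continuous.intervalIntegrable; fun_prop)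
  intro x hx
  have h0 : 0 < x := by have := hx.1; linarith
  have e := Real.BohrMollerup.f_add_nat_eq feq h0 N
  have l := Real.BohrMollerup.f_add_nat_le Real.convexOn_log_Gamma feq (n := N) (by omega) h0 hx.2
  rw [add_comm] at l
  simp only [Function.comp_apply] at e l
  linarith

lemma lower (N : ℕ) (hN : 2 ≤ N) : Real.log (Real.Gamma N) / 2 + 3/8 * Real.log (N - 1) ≤
    II + SS N - N / 2 := by
  rw [← int_sum, ← int_lin]
  apply intervalIntegral.integral_mono_on (by norm_num)
    (by apply Continuous.intervalIntegrable; fun_prop) (ii_sum N)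
  intro x hx
  have h0 : 0 < x := by have := hx.1; linarith
  have e := Real.BohrMollerup.f_add_nat_eq feq h0 N
  have l := Real.BohrMollerup.f_add_nat_ge Real.convexOn_log_Gamma feq hN h0
  rw [add_comm (N : ℝ)] at l
  simp only [Function.comp_apply] at e l
  linarith

lemma lim_Q : Tendsto (fun N : ℕ => II + SS N - N / 2 - Real.log (Real.Gamma N) / 2
    - 3/8 * Real.log N) atTop (𝓝 0) := by
  have h0 : Tendsto (fun N : ℕ => 3/8 * Real.log (1 + (-1) / (N : ℝ))) atTop (𝓝 0) := by
    have : Tendsto (fun N : ℕ => 1 + (-1) / (N : ℝ)) atTop (𝓝 1) := by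
      simpa using (tendsto_const_div_atTop_nhds_zero_nat (-1 : ℝ)).const_add 1
    simpa using (this.log one_ne_zero).const_mul (3/8)
  refine tendsto_of_tendsto_of_tendsto_of_le_of_le' h0 tendsto_const_nhds ?_ ?_
  · filter_upwards [eventually_ge_atTop 2] with N hN
    have := lower N hN
    have hN' : (2 : ℝ) ≤ N := by exact_mod_cast hN
    have e : Real.log (1 + (-1) / (N : ℝ)) = Real.log (N - 1) - Real.log N := by
      rw [← Real.log_div (by linarith) (by linarith)]
      congr 1; field_simp; ring
    rw [e]; linarith
  · filter_upwards [eventually_ge_atTop 2] with N hN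
    have := upper N hN
    linarith

lemma lim_aux (a : ℝ) (ha : 0 < a) : Tendsto (fun N : ℕ => ((N : ℝ) + a) * (Real.log (N + a) - Real.log N))
    atTop (𝓝 a) := by
  have h1 := (Real.tendsto_mul_log_one_add_div_atTop a).comp tendsto_natCast_atTop_atTop
  have h0 : Tendsto (fun N : ℕ => a * Real.log (1 + a / (N : ℝ))) atTop (𝓝 0) := by
    have : Tendsto (fun N : ℕ => 1 + a / (N : ℝ)) atTop (𝓝 1) := by
      simpa using (tendsto_const_div_atTop_nhds_zero_nat a).const_add 1
    simpa using (this.log one_ne_zero).const_mul a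
  have h2 := h1.add h0
  rw [add_zero] at h2
  refine h2.congr' ?_
  filter_upwards [eventually_ge_atTop 1] with N hN
  have hN' : (1 : ℝ) ≤ N := by exact_mod_cast hN
  have e : Real.log (1 + a / (N : ℝ)) = Real.log (N + a) - Real.log N := by
    rw [← Real.log_div (by linarith) (by linarith)]
    congr 1; field_simp
  simp only [Function.comp_apply, e]
  ring

lemma lim_T : Tendsto (fun N : ℕ => (N : ℝ) / 2 + Real.log (Real.Gamma N) / 2 + 3/8 * Real.log N
    + (3/4 * gg (N + 1/2) - 1/4 * gg (N + 1))) atTop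
    (𝓝 (Real.log π / 4 + Real.log 2 / 4 - 1/8)) := by
  have st := Stirling.tendsto_stirlingSeq_sqrt_pi.log (by positivity)
  rw [Real.log_sqrt pi_pos.le] at st
  have := (((st.div_const 2).add_const (Real.log 2 / 4)).sub
    ((lim_aux (1/2) (by norm_num)).const_mul (3/4))).add ((lim_aux 1 one_pos).const_mul (1/4))
  rw [show Real.log π / 4 + Real.log 2 / 4 - 1/8 =
    Real.log π / 2 / 2 + Real.log 2 / 4 - 3/4 * (1/2) + 1/4 * 1 by ring]
  refine this.congr' ?_
  filter_upwards [eventually_ge_atTop 1] with N hN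
  have hN' : (1 : ℝ) ≤ N := by exact_mod_cast hN
  have g : Real.log (Nat.factorial N) = Real.log (Real.Gamma N) + Real.log N := by
    rw [← Real.Gamma_nat_eq_factorial]
    exact feq (by linarith)
  rw [Stirling.log_stirlingSeq_formula, g, Real.log_mul (by norm_num) (by linarith),
    Real.log_div (by linarith) (by positivity), Real.log_exp, gg, gg]
  ring

theorem stmt7 :
    (∫ x in (1/2 : ℝ)..1, Real.log (Real.Gamma x)) =
      Real.log π / 4 - 1/8 + (7/24) * Real.log 2 +
        (3/2) * (deriv riemannZeta (-1)).re := by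
  have h1 := lim_SS.const_add II
  have h2 := lim_Q.add lim_T
  have h3 := tendsto_nhds_unique h1 (h2.congr (fun N => by ring))
  rw [GG_deriv_val] at h3
  change II = _
  linarith
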